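/- Let 0 ≤ s ≤ N and let T be any subgroup of (Z/p^N Z)² that is isomorphic as an abelian group to Z/p^s Z × Z/p^N Z. Then the index of the pointwise stabilizer of T in GL(2, Z/p^N Z) equals (p²−1)·p^{2N−2} if s = 0, and equals (p−1)(p²−1)·p^{2N+2s−3} if s ≥ 1. -/

import Mathlib

open Matrix

/-- The pointwise stabilizer of a set `T` of column vectors in `GL n A`:
`Stab(T) = {M : M v = v for all v ∈ T}`. -/
def pointwiseStab {n A : Type*} [Fintype n] [DecidableEq n] [CommRing A]
    (T : Set (n → A)) : Subgroup (GL n A) where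
  carrier := {M | ∀ v ∈ T, M.val.mulVec v = v}
  one_mem' v hv := by simp
  mul_mem' {M N} hM hN v hv := by
    rw [Units.val_mul, ← Matrix.mulVec_mulVec, hN v hv, hM v hv]
  inv_mem' {M} hM v hv := by
    conv_lhs => rw [← hM v hv]
    rw [Matrix.mulVec_mulVec, ← Units.val_mul, inv_mul_cancel, Units.val_one,
      Matrix.one_mulVec]

/-- The subgroup `T_{s,N}` of `(ℤ/pᴺℤ)²` generated by `e₁ = (1,0)` and
`p^(N−s)·e₂ = (0, p^(N−s))`; it is isomorphic to `ℤ/pˢℤ ⊕ ℤ/pᴺℤ`. -/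
def Tsub (p N s : ℕ) : AddSubgroup (Fin 2 → ZMod (p ^ N)) :=
  AddSubgroup.closure {![1, 0], ![0, (p : ZMod (p ^ N)) ^ (N - s)]}


theorem aux_exists_gl {R : Type*} [CommRing R] (v : Fin 2 → R) (h : IsUnit (v 0) ∨ IsUnit (v 1)) :
    ∃ g : GL (Fin 2) R, g.val *ᵥ ![1, 0] = v := by
  rcases h with h | h
  · refine ⟨GeneralLinearGroup.mk'' !![v 0, 0; v 1, 1] (by simpa [Matrix.det_fin_two] using h), ?_⟩
    ext i; fin_cases i <;> simp [GeneralLinearGroup.mk'', Matrix.mulVec, dotProduct, Fin.sum_univ_two] <;> rfl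
  · refine ⟨GeneralLinearGroup.mk'' !![v 0, 1; v 1, 0] (by simpa [Matrix.det_fin_two] using h), ?_⟩
    ext i; fin_cases i <;> simp [GeneralLinearGroup.mk'', Matrix.mulVec, dotProduct, Fin.sum_univ_two] <;> rfl

theorem aux_isUnit_or {p N : ℕ} (hp : p.Prime) (hN : 1 ≤ N) (x : ZMod (p ^ N)) :
    IsUnit x ∨ ∃ y, x = p * y := by
  haveI : NeZero (p ^ N) := ⟨(pow_pos hp.pos N).ne'⟩
  obtain ⟨n, rfl⟩ := ZMod.natCast_zmod_surjective x
  by_cases h : p ∣ n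
  · right
    obtain ⟨k, rfl⟩ := h
    exact ⟨k, by push_cast; rfl⟩
  · left
    rw [ZMod.isUnit_iff_coprime]
    exact (Nat.Coprime.pow_left N ((Nat.Prime.coprime_iff_not_dvd hp).2 h)).symm

theorem aux_p_pow {p N : ℕ} : (p : ZMod (p ^ N)) ^ N = 0 := by
  have := ZMod.natCast_self (p ^ N)
  push_cast at this; exact this

theorem aux_not_unit_p {p N : ℕ} (hp : p.Prime) (hN : 1 ≤ N) (y : ZMod (p ^ N)) : ¬ IsUnit (p * y) := by
  intro h
  haveI : Fact (1 < p ^ N) := ⟨Nat.one_lt_pow (by omega) hp.one_lt⟩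
  have h2 := h.pow N
  rw [mul_pow, aux_p_pow, zero_mul] at h2
  exact not_isUnit_zero h2

theorem aux_pow_mul_eq_zero {p N s : ℕ} (hp : p.Prime) (hsN : s ≤ N) (x : ZMod (p ^ N)) :
    (p : ZMod (p ^ N)) ^ s * x = 0 ↔ ∃ y, x = (p : ZMod (p ^ N)) ^ (N - s) * y := by
  haveI : NeZero (p ^ N) := ⟨(pow_pos hp.pos N).ne'⟩
  constructor
  · intro h
    obtain ⟨n, rfl⟩ := ZMod.natCast_zmod_surjective x
    have h2 : ((p ^ s * n : ℕ) : ZMod (p ^ N)) = 0 := by push_cast; exact h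
    rw [ZMod.natCast_eq_zero_iff] at h2
    have h3 : p ^ s * p ^ (N - s) ∣ p ^ s * n := by rwa [← pow_add, Nat.add_sub_cancel' hsN]
    obtain ⟨k, rfl⟩ := Nat.dvd_of_mul_dvd_mul_left (pow_pos hp.pos s) h3
    exact ⟨k, by push_cast; rfl⟩
  · rintro ⟨y, rfl⟩
    rw [← mul_assoc, ← pow_add, Nat.add_sub_cancel' hsN, aux_p_pow, zero_mul]

theorem aux_card_ann {p N s : ℕ} (hp : p.Prime) (hsN : s ≤ N) :
    Nat.card {x : ZMod (p ^ N) // (p : ZMod (p ^ N)) ^ s * x = 0} = p ^ s := by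
  haveI : NeZero (p ^ N) := ⟨(pow_pos hp.pos N).ne'⟩
  have h := IsAddCyclic.card_nsmulAddMonoidHom_ker (G := ZMod (p ^ N)) (p ^ s)
  have e : Nat.card (nsmulAddMonoidHom (α := ZMod (p ^ N)) (p ^ s)).ker =
     Nat.card {x : ZMod (p ^ N) // (p : ZMod (p ^ N)) ^ s * x = 0} :=
    Nat.card_congr (Equiv.subtypeEquivRight (fun x => by simp [AddMonoidHom.mem_ker, nsmul_eq_mul]))
  rw [← e, h, Nat.card_zmod, Nat.gcd_eq_right (pow_dvd_pow p hsN)]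

theorem aux_card_nonunits {p N : ℕ} (hp : p.Prime) (hN : 1 ≤ N) :
    Nat.card {x : ZMod (p ^ N) // ¬ IsUnit x} = p ^ (N - 1) := by
  rw [← aux_card_ann hp (Nat.sub_le N 1)]
  refine Nat.card_congr (Equiv.subtypeEquivRight (fun x => ?_))
  rw [aux_pow_mul_eq_zero hp (Nat.sub_le N 1), Nat.sub_sub_self hN, pow_one]
  constructor
  · intro h; exact (aux_isUnit_or hp hN x).resolve_left h
  · rintro ⟨y, rfl⟩; exact aux_not_unit_p hp hN y

@[reducible] def auxAct (R : Type*) [CommRing R] : MulAction (GL (Fin 2) R) (Fin 2 → R) where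
  smul g v := g.val *ᵥ v
  one_smul v := by change (1 : GL (Fin 2) R).val *ᵥ v = v; simp
  mul_smul g h v := by change (g * h).val *ᵥ v = g.val *ᵥ (h.val *ᵥ v); rw [Units.val_mul, Matrix.mulVec_mulVec]

theorem aux_unimod {p N : ℕ} (hp : p.Prime) (hN : 1 ≤ N) (g : GL (Fin 2) (ZMod (p ^ N))) :
    IsUnit ((g.val *ᵥ ![1, 0]) 0) ∨ IsUnit ((g.val *ᵥ ![1, 0]) 1) := by
  by_contra! h
  have hd : IsUnit g.val.det := (Matrix.isUnit_iff_isUnit_det _).1 g.isUnit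
  obtain ⟨a, ha⟩ := (aux_isUnit_or hp hN _).resolve_left h.1
  obtain ⟨b, hb⟩ := (aux_isUnit_or hp hN _).resolve_left h.2
  simp [Matrix.mulVec, dotProduct, Fin.sum_univ_two] at ha hb
  rw [Matrix.det_fin_two, ha, hb] at hd
  refine aux_not_unit_p hp hN (a * g.val 1 1 - g.val 0 1 * b) ?_
  convert hd using 1
  ring

theorem aux_card_nonunimod {p N : ℕ} (hp : p.Prime) (hN : 1 ≤ N) :
    {v : Fin 2 → ZMod (p ^ N) | IsUnit (v 0) ∨ IsUnit (v 1)}.ncard = p ^ (2 * N) - p ^ (2 * N - 2) := by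
  haveI : NeZero (p ^ N) := ⟨(pow_pos hp.pos N).ne'⟩
  have h1 : ({v : Fin 2 → ZMod (p ^ N) | IsUnit (v 0) ∨ IsUnit (v 1)}ᶜ).ncard = p ^ (2 * N - 2) := by
    rw [← Nat.card_coe_set_eq]
    let e : ({v : Fin 2 → ZMod (p ^ N) | IsUnit (v 0) ∨ IsUnit (v 1)}ᶜ : Set _) ≃
      {x : ZMod (p ^ N) // ¬ IsUnit x} × {x : ZMod (p ^ N) // ¬ IsUnit x} :=
      { toFun := fun v => ⟨⟨v.1 0, fun h => v.2 (Or.inl h)⟩, ⟨v.1 1, fun h => v.2 (Or.inr h)⟩⟩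
        invFun := fun w => ⟨![w.1.1, w.2.1], by
          have h1 := w.1.2
          have h2 := w.2.2
          simp [h1, h2]⟩
        left_inv := fun v => by
          ext i; fin_cases i <;> simp
        right_inv := fun w => by simp }
    rw [Nat.card_congr e, Nat.card_prod, aux_card_nonunits hp hN, ← pow_add]
    congr 1; omega
  have h2 := Set.ncard_add_ncard_compl {v : Fin 2 → ZMod (p ^ N) | IsUnit (v 0) ∨ IsUnit (v 1)}
  rw [h1] at h2
  have h3 : Nat.card (Fin 2 → ZMod (p ^ N)) = p ^ (2 * N) := by
    simp [Nat.card_eq_fintype_card, ← pow_mul, mul_comm]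
  omega

theorem aux_index_e1 {p N : ℕ} (hp : p.Prime) (hN : 1 ≤ N) :
    (pointwiseStab ({![1, 0]} : Set (Fin 2 → ZMod (p ^ N)))).index =
      p ^ (2 * N) - p ^ (2 * N - 2) := by
  letI := auxAct (ZMod (p ^ N))
  have h : pointwiseStab ({![1, 0]} : Set (Fin 2 → ZMod (p ^ N))) =
      MulAction.stabilizer (GL (Fin 2) (ZMod (p ^ N))) (![1, 0] : Fin 2 → ZMod (p ^ N)) := by
    ext g
    rw [MulAction.mem_stabilizer_iff]
    change (∀ v ∈ ({![1, 0]} : Set (Fin 2 → ZMod (p ^ N))), g.val *ᵥ v = v) ↔ g.val *ᵥ ![1, 0] = ![1, 0]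
    simp
  rw [h, MulAction.index_stabilizer, ← aux_card_nonunimod hp hN]
  congr 1
  ext v
  rw [MulAction.mem_orbit_iff]
  constructor
  · rintro ⟨g, rfl⟩; exact aux_unimod hp hN g
  · intro hv; exact aux_exists_gl v hv

/-- standard stabilizer counts -/
noncomputable def auxStabEquiv {R : Type*} [CommRing R] (c : R) (S : Subgroup (GL (Fin 2) R))
    (hS : ∀ g, g ∈ S ↔ g.val 0 0 = 1 ∧ g.val 1 0 = 0 ∧ c * g.val 0 1 = 0 ∧ c * (g.val 1 1 - 1) = 0) :
    S ≃ {x : R // c * x = 0} × {u : R // IsUnit u ∧ c * (u - 1) = 0} where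
  toFun g := ⟨⟨g.1.val 0 1, ((hS _).1 g.2).2.2.1⟩, ⟨g.1.val 1 1, by
    have hd : IsUnit g.1.val.det := (Matrix.isUnit_iff_isUnit_det _).1 g.1.isUnit
    have h := (hS _).1 g.2
    rw [Matrix.det_fin_two, h.1, h.2.1] at hd
    exact ⟨by simpa using hd, h.2.2.2⟩⟩⟩
  invFun w := ⟨⟨!![1, w.1.1; 0, w.2.1], !![1, -w.1.1 * (w.2.2.1.unit⁻¹ : Rˣ); 0, (w.2.2.1.unit⁻¹ : Rˣ)],
      by ext i j; fin_cases i <;> fin_cases j <;> simp [Matrix.mul_apply, Fin.sum_univ_two],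
      by ext i j; fin_cases i <;> fin_cases j <;> simp [Matrix.mul_apply, Fin.sum_univ_two, mul_assoc]⟩,
      by rw [hS]; simp [w.1.2, w.2.2.2]⟩
  left_inv g := by
    have h := (hS _).1 g.2
    ext i j; fin_cases i <;> fin_cases j <;> simp [h.1, h.2.1]
  right_inv w := by simp

theorem aux_card_unit_zero {p N : ℕ} (hp : p.Prime) (hN : 1 ≤ N) :
    Nat.card {u : ZMod (p ^ N) // IsUnit u ∧ (p : ZMod (p ^ N)) ^ (N - 0) * (u - 1) = 0} =
      p ^ (N - 1) * (p - 1) := by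
  haveI : NeZero (p ^ N) := ⟨(pow_pos hp.pos N).ne'⟩
  have h1 : {x : ZMod (p ^ N) | ¬ IsUnit x}.ncard = p ^ (N - 1) := by
    rw [← Nat.card_coe_set_eq]; exact aux_card_nonunits hp hN
  have h2 := Set.ncard_add_ncard_compl {x : ZMod (p ^ N) | ¬ IsUnit x}
  have h3 : Nat.card {u : ZMod (p ^ N) // IsUnit u ∧ (p : ZMod (p ^ N)) ^ (N - 0) * (u - 1) = 0} =
      ({x : ZMod (p ^ N) | ¬ IsUnit x}ᶜ).ncard := by
    rw [← Nat.card_coe_set_eq]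
    exact Nat.card_congr (Equiv.subtypeEquivRight (fun x => by simp [aux_p_pow]))
  rw [h3, Nat.mul_sub, mul_one, ← pow_succ, Nat.sub_add_cancel hN]
  rw [h1, Nat.card_zmod] at h2
  omega

theorem aux_card_unit_pos {p N s : ℕ} (hp : p.Prime) (hs : 1 ≤ s) (hsN : s ≤ N) :
    Nat.card {u : ZMod (p ^ N) // IsUnit u ∧ (p : ZMod (p ^ N)) ^ (N - s) * (u - 1) = 0} =
      p ^ (N - s) := by
  rw [← aux_card_ann hp (Nat.sub_le N s)]
  refine Nat.card_congr ⟨fun u => ⟨u.1 - 1, u.2.2⟩, fun x => ⟨x.1 + 1, ?_, by simpa using x.2⟩,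
    fun u => by simp, fun x => by simp⟩
  obtain ⟨y, hy⟩ := (aux_pow_mul_eq_zero hp (Nat.sub_le N s) x.1).1 x.2
  rw [Nat.sub_sub_self hsN] at hy
  refine IsNilpotent.isUnit_add_one ⟨N, ?_⟩
  rw [hy, mul_pow, ← pow_mul, mul_comm s N, pow_mul, aux_p_pow, zero_pow (by omega), zero_mul]

theorem aux_second {p N s : ℕ} (hp : p.Prime) (hsN : s ≤ N)
    (T : AddSubgroup (Fin 2 → ZMod (p ^ N))) (he : ![1, 0] ∈ T) (hc : Nat.card T = p ^ s * p ^ N)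
    (v : Fin 2 → ZMod (p ^ N)) : v ∈ T ↔ (p : ZMod (p ^ N)) ^ s * v 1 = 0 := by
  haveI : NeZero (p ^ N) := ⟨(pow_pos hp.pos N).ne'⟩
  have hx : ∀ x : ZMod (p ^ N), ![x, 0] ∈ T := by
    intro x
    obtain ⟨n, rfl⟩ := ZMod.natCast_zmod_surjective x
    have := T.nsmul_mem he n
    simpa using this
  let I := T.map (Pi.evalAddMonoidHom (fun _ : Fin 2 => ZMod (p ^ N)) 1)
  have hI : ∀ v : Fin 2 → ZMod (p ^ N), v ∈ T ↔ v 1 ∈ I := by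
    intro v
    constructor
    · intro h; exact ⟨v, h, rfl⟩
    · rintro ⟨w, hw, hwv⟩
      have h := T.add_mem hw (hx (v 0 - w 0))
      convert h using 1
      ext i; fin_cases i
      · simp
      · simpa using hwv.symm
  let e : T ≃ I × ZMod (p ^ N) :=
    { toFun := fun v => ⟨⟨v.1 1, (hI _).1 v.2⟩, v.1 0⟩
      invFun := fun w => ⟨![w.2, w.1.1], (hI _).2 (by simp)⟩
      left_inv := fun v => by ext i; fin_cases i <;> simp
      right_inv := fun w => by simp }
  have hcI : Nat.card I = p ^ s := by
    rw [Nat.card_congr e, Nat.card_prod, Nat.card_zmod] at hc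
    exact Nat.eq_of_mul_eq_mul_right (pow_pos hp.pos N) hc
  have hsub : (I : Set (ZMod (p ^ N))) ⊆ {x | (p : ZMod (p ^ N)) ^ s * x = 0} := by
    intro x hxI
    have h := card_nsmul_eq_zero' (x := (⟨x, hxI⟩ : I))
    rw [hcI] at h
    have h2 := congrArg Subtype.val h
    simpa [nsmul_eq_mul] using h2
  have heq := Set.eq_of_subset_of_ncard_le hsub (by
    rw [← Nat.card_coe_set_eq, ← Nat.card_coe_set_eq]
    exact ((aux_card_ann hp hsN).trans hcI.symm).le) (Set.toFinite _)
  rw [hI, ← SetLike.mem_coe, heq]; rfl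

theorem aux_mem_stab {p N s : ℕ} (hp : p.Prime) (hsN : s ≤ N)
    (T : Set (Fin 2 → ZMod (p ^ N)))
    (hT : ∀ v, v ∈ T ↔ (p : ZMod (p ^ N)) ^ s * v 1 = 0) (g : GL (Fin 2) (ZMod (p ^ N))) :
    g ∈ pointwiseStab T ↔ g.val 0 0 = 1 ∧ g.val 1 0 = 0 ∧
      (p : ZMod (p ^ N)) ^ (N - s) * g.val 0 1 = 0 ∧
      (p : ZMod (p ^ N)) ^ (N - s) * (g.val 1 1 - 1) = 0 := by
  change (∀ v ∈ T, g.val *ᵥ v = v) ↔ _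
  constructor
  · intro h
    have h1 := h ![1, 0] ((hT _).2 (by simp))
    have h2 := h ![0, (p : ZMod (p ^ N)) ^ (N - s)]
      ((hT _).2 (by simp [← pow_add, Nat.add_sub_cancel' hsN, aux_p_pow]))
    have a := congrFun h1 0
    have b := congrFun h1 1
    have c := congrFun h2 0
    have d := congrFun h2 1
    simp [Matrix.mulVec, dotProduct, Fin.sum_univ_two] at a b c d
    refine ⟨a, b, by rw [mul_comm]; exact c, by linear_combination d⟩
  · rintro ⟨a, b, c, d⟩ v hv
    obtain ⟨y, hy⟩ := (aux_pow_mul_eq_zero hp hsN _).1 ((hT _).1 hv)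
    ext i; fin_cases i
    · simp [Matrix.mulVec, dotProduct, Fin.sum_univ_two, a, hy]
      linear_combination y * c
    · simp [Matrix.mulVec, dotProduct, Fin.sum_univ_two, b, hy]
      linear_combination y * d

theorem aux_card_stab {p N s : ℕ} (hp : p.Prime) (hN : 1 ≤ N) (hsN : s ≤ N)
    (T : Set (Fin 2 → ZMod (p ^ N)))
    (hT : ∀ v, v ∈ T ↔ (p : ZMod (p ^ N)) ^ s * v 1 = 0) :
    Nat.card (pointwiseStab T) =
      p ^ (N - s) * if s = 0 then p ^ (N - 1) * (p - 1) else p ^ (N - s) := by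
  rw [Nat.card_congr (auxStabEquiv _ _ (aux_mem_stab hp hsN T hT)), Nat.card_prod,
    aux_card_ann hp (Nat.sub_le N s)]
  split_ifs with h
  · subst h; rw [aux_card_unit_zero hp hN]
  · rw [aux_card_unit_pos hp (by omega) hsN]

theorem aux_card_GL {p N : ℕ} (hp : p.Prime) (hN : 1 ≤ N) :
    Nat.card (GL (Fin 2) (ZMod (p ^ N))) =
      (p ^ (2 * N) - p ^ (2 * N - 2)) * (p ^ N * (p ^ (N - 1) * (p - 1))) := by
  have h1 := aux_index_e1 hp hN
  have h2 := aux_card_stab (s := 0) hp hN (Nat.zero_le N)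
    {v : Fin 2 → ZMod (p ^ N) | (p : ZMod (p ^ N)) ^ 0 * v 1 = 0} (fun v => Iff.rfl)
  have h3 : pointwiseStab {v : Fin 2 → ZMod (p ^ N) | (p : ZMod (p ^ N)) ^ 0 * v 1 = 0} =
      pointwiseStab ({![1, 0]} : Set (Fin 2 → ZMod (p ^ N))) := by
    ext g
    rw [aux_mem_stab (s := 0) hp (Nat.zero_le N)
      {v : Fin 2 → ZMod (p ^ N) | (p : ZMod (p ^ N)) ^ 0 * v 1 = 0} (fun v => Iff.rfl)]
    change _ ↔ (∀ v ∈ ({![1, 0]} : Set (Fin 2 → ZMod (p ^ N))), g.val *ᵥ v = v)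
    simp only [Set.mem_singleton_iff, forall_eq]
    simp [aux_p_pow, funext_iff, Matrix.mulVec, dotProduct, Fin.sum_univ_two]
  rw [← Subgroup.index_mul_card (pointwiseStab ({![1, 0]} : Set (Fin 2 → ZMod (p ^ N)))), h1, ← h3, h2]
  simp

theorem aux_conj {R : Type*} [CommRing R] (g : GL (Fin 2) R) (T T' : Set (Fin 2 → R))
    (h : ∀ v, v ∈ T' ↔ g.val *ᵥ v ∈ T) :
    Nat.card (pointwiseStab T') = Nat.card (pointwiseStab T) := by
  have key : ∀ m : GL (Fin 2) R, m ∈ pointwiseStab T' ↔ g * m * g⁻¹ ∈ pointwiseStab T := by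
    intro m
    change (∀ v ∈ T', m.val *ᵥ v = v) ↔ (∀ v ∈ T, (g * m * g⁻¹).val *ᵥ v = v)
    have c1 : ∀ v, g.val *ᵥ ((g⁻¹).val *ᵥ v) = v := fun v => by
      rw [Matrix.mulVec_mulVec, ← Units.val_mul, mul_inv_cancel, Units.val_one, Matrix.one_mulVec]
    have c2 : ∀ v, (g⁻¹).val *ᵥ (g.val *ᵥ v) = v := fun v => by
      rw [Matrix.mulVec_mulVec, ← Units.val_mul, inv_mul_cancel, Units.val_one, Matrix.one_mulVec]
    constructor
    · intro hm v hv
      rw [Units.val_mul, Units.val_mul, ← Matrix.mulVec_mulVec, ← Matrix.mulVec_mulVec,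
        hm _ ((h _).2 (by rwa [c1])), c1]
    · intro hm v hv
      have := hm _ ((h v).1 hv)
      rw [Units.val_mul, Units.val_mul, ← Matrix.mulVec_mulVec, ← Matrix.mulVec_mulVec, c2] at this
      rw [← c2 (m.val *ᵥ v), this, c2]
  exact Nat.card_congr ((MulAut.conj g).toEquiv.subtypeEquiv (fun m => by simpa using key m))

theorem aux_main {p N s : ℕ} (hp : p.Prime) (hN : 1 ≤ N) (hsN : s ≤ N)
    (T : AddSubgroup (Fin 2 → ZMod (p ^ N)))
    (hT : Nonempty (T ≃+ ZMod (p ^ s) × ZMod (p ^ N))) :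
    Nat.card (pointwiseStab (T : Set (Fin 2 → ZMod (p ^ N)))) =
      p ^ (N - s) * if s = 0 then p ^ (N - 1) * (p - 1) else p ^ (N - s) := by
  obtain ⟨e⟩ := hT
  have hv : IsUnit ((e.symm (0, 1)).1 0) ∨ IsUnit ((e.symm (0, 1)).1 1) := by
    by_contra! h
    obtain ⟨a, ha⟩ := (aux_isUnit_or hp hN _).resolve_left h.1
    obtain ⟨b, hb⟩ := (aux_isUnit_or hp hN _).resolve_left h.2
    have hpz : (p : ZMod (p ^ N)) ^ (N - 1) * p = 0 := by
      rw [← pow_succ, Nat.sub_add_cancel hN, aux_p_pow]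
    have h0 : (p ^ (N - 1)) • e.symm (0, 1) = 0 := by
      ext i; fin_cases i
      · simp [ha, nsmul_eq_mul, ← mul_assoc, hpz]
      · simp [hb, nsmul_eq_mul, ← mul_assoc, hpz]
    rw [← map_nsmul] at h0
    have h1 := (e.symm.map_eq_zero_iff).1 h0
    have h2 := congrArg Prod.snd h1
    simp only [Prod.smul_mk, Prod.snd_zero, nsmul_eq_mul, mul_one] at h2
    rw [ZMod.natCast_eq_zero_iff] at h2
    have := (Nat.pow_dvd_pow_iff_le_right hp.one_lt).1 h2
    omega
  obtain ⟨g, hg⟩ := aux_exists_gl _ hv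
  let T' : AddSubgroup (Fin 2 → ZMod (p ^ N)) := T.comap (Matrix.mulVecLin g.val).toAddMonoidHom
  have hT' : ∀ v, v ∈ (T' : Set (Fin 2 → ZMod (p ^ N))) ↔ g.val *ᵥ v ∈ (T : Set (Fin 2 → ZMod (p ^ N))) :=
    fun v => Iff.rfl
  rw [← aux_conj g _ _ hT']
  refine aux_card_stab hp hN hsN _ (aux_second hp hsN T' ?_ ?_)
  · refine (hT' _).2 ?_
    rw [hg]; exact (e.symm (0, 1)).2
  · have : Nat.card T' = Nat.card T := by
      letI := auxAct (ZMod (p ^ N))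
      exact Nat.card_congr ((MulAction.toPerm g).subtypeEquiv (fun v => Iff.rfl))
    rw [this, Nat.card_congr e.toEquiv, Nat.card_prod, Nat.card_zmod, Nat.card_zmod]

/-- Let `0 ≤ s ≤ N` and let `T` be any subgroup of `(ℤ/pᴺℤ)²` isomorphic as an
abelian group to `ℤ/pˢℤ × ℤ/pᴺℤ`. Then the index of the pointwise stabilizer of `T` in
`GL(2, ℤ/pᴺℤ)` equals `(p²−1)·p^(2N−2)` if `s = 0`, and `(p−1)(p²−1)·p^(2N+2s−3)` if `s ≥ 1`. -/
theorem index_pointwiseStab_of_isomorphic (p N s : ℕ) (hp : p.Prime) (hN : 1 ≤ N) (hsN : s ≤ N)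
    (T : AddSubgroup (Fin 2 → ZMod (p ^ N)))
    (hT : Nonempty (T ≃+ ZMod (p ^ s) × ZMod (p ^ N))) :
    (s = 0 →
      (pointwiseStab (T : Set (Fin 2 → ZMod (p ^ N)))).index =
        (p ^ 2 - 1) * p ^ (2 * N - 2)) ∧
    (1 ≤ s →
      (pointwiseStab (T : Set (Fin 2 → ZMod (p ^ N)))).index =
        (p - 1) * (p ^ 2 - 1) * p ^ (2 * N + 2 * s - 3)) := by
  have hc := aux_main hp hN hsN T hT
  have hG := Subgroup.index_mul_card (pointwiseStab (T : Set (Fin 2 → ZMod (p ^ N))))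
  rw [hc, aux_card_GL hp hN] at hG
  have e1 : p ^ (2 * N) - p ^ (2 * N - 2) = (p ^ 2 - 1) * p ^ (2 * N - 2) := by
    rw [Nat.sub_mul, one_mul, ← pow_add]
    congr 2; omega
  have hp1 : 0 < p - 1 := Nat.sub_pos_of_lt hp.one_lt
  have hp0 := hp.pos
  rw [e1] at hG
  constructor
  · rintro rfl
    rw [if_pos rfl, Nat.sub_zero] at hG
    exact Nat.eq_of_mul_eq_mul_right (by positivity) hG
  · intro hs
    rw [if_neg (by omega)] at hG
    refine Nat.eq_of_mul_eq_mul_right (m := p ^ (N - s) * p ^ (N - s)) (by positivity) (hG.trans ?_)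
    have e2 : p ^ (2 * N - 2) * (p ^ N * p ^ (N - 1)) =
        p ^ (2 * N + 2 * s - 3) * (p ^ (N - s) * p ^ (N - s)) := by
      simp only [← pow_add]
      congr 1; omega
    linear_combination (p - 1) * (p ^ 2 - 1) * e2
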